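/- arXiv:2006.04710 — 6 statements merged into one kernel-verified Lean document; each statement's English description precedes it below -/
import Mathlib

section
/- Dot-product self-attention is not Lipschitz. Precisely: let N ≥ 2 and D ≥ 1 be integers and let A ∈ ℝ^{D×D} be a nonzero matrix. Define f : ℝ^{N×D} → ℝ^{N×D} by f(X) = P X, where for X with rows x_1, …, x_N ∈ ℝ^D the stochastic matrix P ∈ ℝ^{N×N} is given by P_{ij} = exp(x_i⊤ A x_j) / Σ_{k=1}^N exp(x_i⊤ A x_k). Then f is not Lipschitz with respect to the Frobenius norm: there is no constant K ≥ 0 such that ‖f(X) − f(X')‖_F ≤ K ‖X − X'‖_F for all X, X' ∈ ℝ^{N×D}. -/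
open Matrix BigOperators

/-- Frobenius norm of a real matrix. -/
noncomputable def frobNorm {m n : Type*} [Fintype m] [Fintype n]
    (M : Matrix m n ℝ) : ℝ :=
  Real.sqrt (∑ i, ∑ j, M i j ^ 2)

/-- Dot-product self-attention `f(X) = P X` with
`P i j = exp(xᵢ ⬝ A xⱼ) / ∑ₖ exp(xᵢ ⬝ A xₖ)`. -/
noncomputable def dpAttn {N D : ℕ} (A : Matrix (Fin D) (Fin D) ℝ)
    (X : Matrix (Fin N) (Fin D) ℝ) : Matrix (Fin N) (Fin D) ℝ :=
  Matrix.of fun i d =>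
    ∑ j, (Real.exp (X i ⬝ᵥ A.mulVec (X j)) /
      ∑ k, Real.exp (X i ⬝ᵥ A.mulVec (X k))) * X j d

theorem abs_apply_le_frobNorm {m n : Type*} [Fintype m] [Fintype n]
    (M : Matrix m n ℝ) (i : m) (j : n) : |M i j| ≤ frobNorm M := by
  rw [← Real.sqrt_sq_eq_abs]
  refine Real.sqrt_le_sqrt ?_
  calc M i j ^ 2 ≤ ∑ l, M i l ^ 2 :=
        Finset.single_le_sum (f := fun l => M i l ^ 2) (fun _ _ => sq_nonneg _)
          (Finset.mem_univ j)
    _ ≤ ∑ k, ∑ l, M k l ^ 2 :=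
        Finset.single_le_sum (f := fun k => ∑ l, M k l ^ 2)
          (fun _ _ => Finset.sum_nonneg fun _ _ => sq_nonneg _) (Finset.mem_univ i)

/-- The sequence with first row `s • e_p`, second row `t • e_q` and all other rows zero. -/
def twoRows {D : ℕ} (n : ℕ) (p q : Fin D) (s t : ℝ) : Matrix (Fin (n + 2)) (Fin D) ℝ :=
  Matrix.of (vecCons (Pi.single p s) (vecCons (Pi.single q t) 0))

theorem frobNorm_twoRows_sub {D n : ℕ} (p q : Fin D) (s t : ℝ) :
    frobNorm (twoRows n p q s t - twoRows n p q 0 t) = |s| := by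
  rw [← Real.sqrt_sq_eq_abs, frobNorm]
  simp [twoRows, Fin.sum_univ_succ, Pi.single_apply, ite_pow]

theorem dpAttn_twoRows {D n : ℕ} (A : Matrix (Fin D) (Fin D) ℝ) (p q : Fin D) (s t : ℝ) :
    dpAttn A (twoRows n p q s t) 0 q =
      (Real.exp (A p p * s ^ 2) * (if q = p then s else 0) + Real.exp (A p q * (s * t)) * t) /
        (Real.exp (A p p * s ^ 2) + (Real.exp (A p q * (s * t)) + n)) := by
  have h₀ : twoRows n p q s t 0 = Pi.single p s := rfl
  have h₁ : twoRows n p q s t 1 = Pi.single q t := rfl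
  have h₂ (k : Fin n) : twoRows n p q s t k.succ.succ = 0 := rfl
  simp only [dpAttn, Matrix.of_apply, Fin.sum_univ_succ, Fin.succ_zero_eq_one, h₀, h₁, h₂]
  simp [Pi.single_apply]
  split_ifs <;> ring_nf

/-- Dot-product self-attention is not Lipschitz (w.r.t. the Frobenius norm). -/
theorem dp_attention_not_lipschitz
    (N D : ℕ) (hN : 2 ≤ N) (hD : 1 ≤ D)
    (A : Matrix (Fin D) (Fin D) ℝ) (hA : A ≠ 0) :
    ¬ ∃ K : ℝ, 0 ≤ K ∧ ∀ X X' : Matrix (Fin N) (Fin D) ℝ,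
      frobNorm (dpAttn A X - dpAttn A X') ≤ K * frobNorm (X - X') := by
  rintro ⟨K, -, hK⟩
  obtain ⟨n, rfl⟩ := Nat.exists_eq_add_of_le' hN
  obtain ⟨p, q, hpq⟩ : ∃ p q, A p q ≠ 0 := by
    by_contra! h
    exact hA (Matrix.ext h)
  set G : ℝ → ℝ := fun s =>
    (Real.exp (A p p * s ^ 2) * (if q = p then s ^ 2 else 0) + Real.exp (A p q)) /
      (Real.exp (A p p * s ^ 2) + (Real.exp (A p q) + n)) - 1 / (n + 2) with hG
  have hbound : ∀ s : ℝ, 0 < s → |G s| ≤ K * s ^ 2 := by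
    intro s hs
    have h := (abs_apply_le_frobNorm _ 0 q).trans
      (hK (twoRows n p q s s⁻¹) (twoRows n p q 0 s⁻¹))
    rw [frobNorm_twoRows_sub, Matrix.sub_apply, dpAttn_twoRows, dpAttn_twoRows,
      mul_inv_cancel₀ hs.ne', abs_of_pos hs] at h
    have hGs : G s = s * ((Real.exp (A p p * s ^ 2) * (if q = p then s else 0) +
        Real.exp (A p q * 1) * s⁻¹) / (Real.exp (A p p * s ^ 2) + (Real.exp (A p q * 1) + n)) -
        (Real.exp (A p p * 0 ^ 2) * (if q = p then 0 else 0) +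
        Real.exp (A p q * (0 * s⁻¹)) * s⁻¹) /
        (Real.exp (A p p * 0 ^ 2) + (Real.exp (A p q * (0 * s⁻¹)) + n))) := by
      have : (1 : ℝ) + (1 + n) = n + 2 := by ring
      simp only [hG, mul_one, zero_mul, mul_zero, ne_eq, OfNat.ofNat_ne_zero, not_false_eq_true,
        zero_pow, Real.exp_zero, ite_self, zero_add, one_mul, this]
      split_ifs
      · field_simp
      · field_simp
        ring
    rw [hGs, abs_mul, abs_of_pos hs]
    calc _ ≤ s * (K * s) := mul_le_mul_of_nonneg_left h hs.le
      _ = K * s ^ 2 := by ring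
  have hcont : Continuous G := by
    refine Continuous.sub (Continuous.div ?_ (by fun_prop) fun s => by positivity)
      continuous_const
    split_ifs <;> fun_prop
  have hle : |G 0| ≤ K * 0 ^ 2 :=
    le_of_tendsto_of_tendsto
      (hcont.abs.continuousAt.tendsto.mono_left (nhdsWithin_le_nhds (s := Set.Ioi 0)))
      ((by fun_prop : Continuous fun s : ℝ => K * s ^ 2).continuousAt.tendsto.mono_left
        nhdsWithin_le_nhds)
      (Filter.eventually_of_mem self_mem_nhdsWithin hbound)
  have hzero : G 0 = 0 := abs_nonpos_iff.mp (by simpa using hle)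
  have hn : (0 : ℝ) < n + 1 := by positivity
  have hexp : Real.exp (A p q) = 1 := by
    simp only [hG, ne_eq, OfNat.ofNat_ne_zero, not_false_eq_true, zero_pow, mul_zero,
      Real.exp_zero, ite_self, zero_add, sub_eq_zero] at hzero
    rw [div_eq_div_iff (by positivity) (by positivity)] at hzero
    exact mul_right_cancel₀ hn.ne' (by linarith)
  exact hpq (Real.exp_eq_one_iff _ |>.mp hexp)
end

section
/- Adding bias terms to the queries and keys does not make dot-product self-attention Lipschitz. Precisely: let N ≥ 2, D ≥ 1, D' ≥ 1 be integers, let W^Q ∈ ℝ^{D×D'} have rank D' (full column rank), let W^K ∈ ℝ^{D×D'} be nonzero, and let b^Q, b^K ∈ ℝ^{D'}. Define f : ℝ^{N×D} → ℝ^{N×D} by f(X) = P X, where for X with rows x_1, …, x_N ∈ ℝ^D the stochastic matrix P ∈ ℝ^{N×N} is given by P_{ij} = exp(L_{ij}) / Σ_{k=1}^N exp(L_{ik}) with logits L_{ij} = (W^{Q⊤} x_i + b^Q)⊤ (W^{K⊤} x_j + b^K) / √D'. Then f is not Lipschitz with respect to the Frobenius norm: there is no constant K ≥ 0 such that ‖f(X)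 − f(X')‖_F ≤ K ‖X − X'‖_F for all X, X' ∈ ℝ^{N×D}. -/
open Matrix BigOperators

/-- Dot-product self-attention with bias terms on queries and keys:
`f(X) = P X` where `P i j ∝ exp(((WQᵀ xᵢ + bQ) ⬝ (WKᵀ xⱼ + bK)) / √D')`. -/
noncomputable def dpBiasAttn {N D D' : ℕ}
    (WQ WK : Matrix (Fin D) (Fin D') ℝ) (bQ bK : Fin D' → ℝ)
    (X : Matrix (Fin N) (Fin D) ℝ) : Matrix (Fin N) (Fin D) ℝ :=
  Matrix.of fun i d =>
    ∑ j, (Real.exp (((WQᵀ.mulVec (X i) + bQ) ⬝ᵥ (WKᵀ.mulVec (X j) + bK)) / Real.sqrt D') /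
      ∑ k, Real.exp (((WQᵀ.mulVec (X i) + bQ) ⬝ᵥ (WKᵀ.mulVec (X k) + bK)) / Real.sqrt D')) * X j d

theorem frobNorm_smul {m n : Type*} [Fintype m] [Fintype n]
    (s : ℝ) (M : Matrix m n ℝ) : frobNorm (s • M) = |s| * frobNorm M := by
  simp only [frobNorm, Matrix.smul_apply, smul_eq_mul, mul_pow, ← Finset.mul_sum]
  rw [Real.sqrt_mul (sq_nonneg s), Real.sqrt_sq_eq_abs]

theorem mulVec_transpose_surjective_of_rank_eq {D D' : ℕ} {W : Matrix (Fin D) (Fin D') ℝ}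
    (hW : W.rank = D') : Function.Surjective Wᵀ.mulVec := by
  have h : LinearMap.range Wᵀ.mulVecLin = ⊤ := by
    apply Submodule.eq_top_of_finrank_eq
    rw [Module.finrank_fin_fun]
    exact (Matrix.rank_transpose W).trans hW
  intro y
  obtain ⟨x, hx⟩ := LinearMap.range_eq_top.mp h y
  exact ⟨x, hx⟩

/-- A weighted mean of the points `x + s⁻¹ y j`, rescaled by `s`. -/
theorem mul_sum_div_mul_add_inv_mul {ι : Type*} [Fintype ι] {s : ℝ} (hs : s ≠ 0) (a y : ι → ℝ)
    (ha : ∑ k, a k ≠ 0) (x : ℝ) :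
    s * ∑ j, a j / (∑ k, a k) * (x + s⁻¹ * y j) = s * x + ∑ j, a j / (∑ k, a k) * y j := by
  have h : ∑ j, a j / (∑ k, a k) = 1 := by rw [← Finset.sum_div, div_self ha]
  calc s * ∑ j, a j / (∑ k, a k) * (x + s⁻¹ * y j)
      = ∑ j, (a j / (∑ k, a k) * (s * x) + a j / (∑ k, a k) * y j) := by
        rw [Finset.mul_sum]
        refine Finset.sum_congr rfl fun j _ => ?_
        field_simp
    _ = _ := by rw [Finset.sum_add_distrib, ← Finset.sum_mul, h, one_mul]

/-- Dot-product self-attention with bias terms is still not Lipschitz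
(w.r.t. the Frobenius norm), provided `WQ` has full column rank and `WK ≠ 0`. -/
theorem dp_attention_bias_not_lipschitz
    (N D D' : ℕ) (hN : 2 ≤ N) (hD : 1 ≤ D) (hD' : 1 ≤ D')
    (WQ WK : Matrix (Fin D) (Fin D') ℝ)
    (hWQ : WQ.rank = D') (hWK : WK ≠ 0) (bQ bK : Fin D' → ℝ) :
    ¬ ∃ K : ℝ, 0 ≤ K ∧ ∀ X X' : Matrix (Fin N) (Fin D) ℝ,
      frobNorm (dpBiasAttn WQ WK bQ bK X - dpBiasAttn WQ WK bQ bK X') ≤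
        K * frobNorm (X - X') := by
  rintro ⟨K, -, hK⟩
  obtain ⟨d, e, hde⟩ : ∃ d e, WK d e ≠ 0 := by
    by_contra! h
    exact hWK (Matrix.ext h)
  let v : Fin D → ℝ := Pi.single d 1
  have hsurj := mulVec_transpose_surjective_of_rank_eq hWQ
  obtain ⟨x, hx⟩ := hsurj (-bQ)
  obtain ⟨u, hu⟩ := hsurj (WKᵀ.mulVec v)
  let i₀ : Fin N := ⟨0, by omega⟩
  let i₁ : Fin N := ⟨1, by omega⟩
  have hi : i₀ ≠ i₁ := by simp [i₀, i₁]
  have hN0 : (N : ℝ) ≠ 0 := by positivity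
  let q := WKᵀ.mulVec v
  let A := q ⬝ᵥ (WKᵀ.mulVec x + bK) / Real.sqrt D'
  let c := q ⬝ᵥ q / Real.sqrt D'
  let g := q ⬝ᵥ WKᵀ.mulVec u / Real.sqrt D'
  have hc : 0 < c := by
    have hq : q e ≠ 0 := by simpa [q, v] using hde
    refine div_pos ?_ (Real.sqrt_pos.mpr (by exact_mod_cast hD'))
    exact Finset.sum_pos' (fun _ _ => mul_self_nonneg _)
      ⟨e, Finset.mem_univ e, mul_self_pos.mpr hq⟩
  let α : Fin N → ℝ := fun j => if j = i₁ then 1 else 0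
  let β : Fin N → ℝ := fun j => if j = i₀ then 1 else 0
  let E : ℝ → Fin N → ℝ := fun s j => Real.exp (s * A + α j * c + β j * (s ^ 2 * g))
  have hE : ∀ s, 0 < ∑ k, E s k := fun s =>
    Finset.sum_pos (fun _ _ => Real.exp_pos _) ⟨i₀, Finset.mem_univ _⟩
  let X : ℝ → Matrix (Fin N) (Fin D) ℝ := fun s j => x + s⁻¹ • α j • v
  let X' : ℝ → Matrix (Fin N) (Fin D) ℝ := fun s j => x + s⁻¹ • (α j • v + (β j * s ^ 2) • u)
  let B : Matrix (Fin N) (Fin D) ℝ := fun j => β j • u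
  let h : ℝ → ℝ := fun s => ∑ j, E s j / (∑ k, E s k) * (α j + β j * s ^ 2 * u d) - 1 / N
  have hf : ∀ s, s ≠ 0 → s * dpBiasAttn WQ WK bQ bK (X s) i₀ d = s * x d + 1 / N := by
    intro s hs
    have hX : X s i₀ = x := by simp [X, α, hi]
    have key := mul_sum_div_mul_add_inv_mul hs (fun _ : Fin N => (1 : ℝ)) α
      (by simpa using hN0) (x d)
    simp only [dpBiasAttn, Matrix.of_apply, hX, hx, neg_add_cancel, zero_dotProduct, zero_div,
      Real.exp_zero]
    have hXd : ∀ j, X s j d = x d + s⁻¹ * α j := by simp [X, v]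
    simp only [hXd]
    rw [key]
    simp [α]
  have hf' : ∀ s, s ≠ 0 → s * dpBiasAttn WQ WK bQ bK (X' s) i₀ d = s * x d + (h s + 1 / N) := by
    intro s hs
    have hX : WQᵀ.mulVec (X' s i₀) + bQ = s • q := by
      have : X' s i₀ = x + s • u := by
        simp only [X', α, β, hi, if_true, if_false, zero_smul, zero_add, one_mul, smul_smul]
        congr 2
        field_simp
      rw [this, Matrix.mulVec_add, Matrix.mulVec_smul, hx, hu]
      simp [q]
    have hL : ∀ j, (s • q) ⬝ᵥ (WKᵀ.mulVec (X' s j) + bK) / Real.sqrt D' =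
        s * A + α j * c + β j * (s ^ 2 * g) := by
      intro j
      simp only [X', A, c, g, Matrix.mulVec_add, Matrix.mulVec_smul, dotProduct_add,
        smul_dotProduct, dotProduct_smul, smul_eq_mul]
      change _ = s * ((q ⬝ᵥ WKᵀ.mulVec x + q ⬝ᵥ bK) / _) + α j * (q ⬝ᵥ WKᵀ.mulVec v / _) + _
      field_simp
      ring
    have hXd : ∀ j, X' s j d = x d + s⁻¹ * (α j + β j * s ^ 2 * u d) := by
      simp [X', v, mul_add]
    have key := mul_sum_div_mul_add_inv_mul hs (E s) (fun j => α j + β j * s ^ 2 * u d)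
      (hE s).ne' (x d)
    simp only [dpBiasAttn, Matrix.of_apply, hX, hL, hXd]
    simp only [h, sub_add_cancel]
    exact key
  have hbound : ∀ s, s ≠ 0 → |h s| ≤ K * frobNorm B * s ^ 2 := by
    intro s hs
    have hB : X' s - X s = s • B := by
      ext j k
      change x k + s⁻¹ * (α j * v k + β j * s ^ 2 * u k) - (x k + s⁻¹ * (α j * v k)) =
        s * (β j * u k)
      field_simp
      ring
    have h1 := (abs_apply_le_frobNorm _ i₀ d).trans (hK (X' s) (X s))
    rw [hB, frobNorm_smul, Matrix.sub_apply] at h1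
    have h2 : h s = s *
        (dpBiasAttn WQ WK bQ bK (X' s) i₀ d - dpBiasAttn WQ WK bQ bK (X s) i₀ d) := by
      rw [mul_sub, hf s hs, hf' s hs]
      ring
    rw [h2, abs_mul]
    calc _ ≤ |s| * (K * (|s| * frobNorm B)) := by gcongr
      _ = K * frobNorm B * |s| ^ 2 := by ring
      _ = _ := by rw [sq_abs]
  have hcont : Continuous h := by
    have hEc : ∀ j, Continuous fun s => E s j := fun j => by fun_prop
    refine Continuous.sub (continuous_finsetSum _ fun j _ => ?_) continuous_const
    refine ((hEc j).div (continuous_finsetSum _ fun k _ => hEc k) fun s => (hE s).ne').mul ?_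
    fun_prop
  have h0 : |h 0| ≤ K * frobNorm B * 0 ^ 2 := by
    have hr : Continuous fun s : ℝ => K * frobNorm B * s ^ 2 := by fun_prop
    exact le_of_tendsto_of_tendsto (hcont.abs.continuousAt.tendsto.mono_left nhdsWithin_le_nhds)
      (hr.continuousAt.tendsto.mono_left nhdsWithin_le_nhds)
      (eventually_nhdsWithin_of_forall (s := {0}ᶜ) hbound)
  have hh : h 0 = Real.exp c / (∑ k, E 0 k) - 1 / N := by
    simp [h, E, α]
  have hlt : ∑ k, E 0 k < N * Real.exp c := by
    have : ∑ k, E 0 k < ∑ _k : Fin N, Real.exp c := by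
      refine Finset.sum_lt_sum (fun k _ => ?_) ⟨i₀, Finset.mem_univ _, ?_⟩
      · simp only [E, α]
        split_ifs <;> simp [hc.le]
      · simp [E, α, hi, hc]
    simpa using this
  have hpos : 0 < h 0 := by
    rw [hh, sub_pos, div_lt_div_iff₀ (by positivity) (hE 0)]
    linarith
  have := abs_pos.mpr hpos.ne'
  linarith
end

section
/- L2 self-attention with untied (distinct) query and key weight matrices is not Lipschitz. Precisely: let N ≥ 2, D ≥ 1, D' ≥ 1 be integers, let W^Q, W^K ∈ ℝ^{D×D'} with W^Q ≠ W^K and with W^K of rank D' (full column rank). Define f̃ : ℝ^{N×D} → ℝ^{N×D} by f̃(X) = P X, where for X with rows x_1, …, x_N ∈ ℝ^D the stochastic matrix P ∈ ℝ^{N×N} is given by P_{ij} = exp(−‖W^{Q⊤} x_i − W^{K⊤} x_j‖₂²) / Σ_{k=1}^N exp(−‖W^{Q⊤} x_i − W^{K⊤} x_k‖₂²). Then f̃ is not Lipschitz with respect to the Frobenius norm: there is no constant K ≥ 0 such that ‖f̃(X) − f̃(X')‖_F ≤ K ‖X − X'‖_F for all X, X' ∈ ℝ^{N×D}. -/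
open Matrix BigOperators

/-- L2 self-attention with (possibly untied) query and key weights:
`f̃(X) = P X` where `P i j ∝ exp(−‖WQᵀ xᵢ − WKᵀ xⱼ‖₂²)`. -/
noncomputable def l2AttnUntied {N D D' : ℕ}
    (WQ WK : Matrix (Fin D) (Fin D') ℝ)
    (X : Matrix (Fin N) (Fin D) ℝ) : Matrix (Fin N) (Fin D) ℝ :=
  Matrix.of fun i d =>
    ∑ j, (Real.exp (-(∑ m, (WQᵀ.mulVec (X i) m - WKᵀ.mulVec (X j) m) ^ 2)) /
      ∑ k, Real.exp (-(∑ m, (WQᵀ.mulVec (X i) m - WKᵀ.mulVec (X k) m) ^ 2))) * X j d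

theorem mulVec_surjective_of_rank_eq {m n : ℕ} {A : Matrix (Fin m) (Fin n) ℝ}
    (hA : A.rank = m) : Function.Surjective A.mulVec := by
  have h : LinearMap.range A.mulVecLin = ⊤ :=
    Submodule.eq_top_of_finrank_eq (by simpa [Matrix.rank] using hA)
  exact LinearMap.range_eq_top.mp h

/-- The first output row when the first input row is `t • u` and all the others are
`t • u + τ • d`, where `d` points along the query-key mismatch of `u`. -/
theorem l2AttnUntied_cons_zero_apply {n D D' : ℕ} (WQ WK : Matrix (Fin D) (Fin D') ℝ)
    (u d : Fin D → ℝ) (a : Fin D' → ℝ) (ha : WQᵀ *ᵥ u - WKᵀ *ᵥ u = a)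
    (hd : WKᵀ *ᵥ d = (2 : ℝ) • a) (t τ : ℝ) (e : Fin D) :
    l2AttnUntied WQ WK
        (Matrix.of (Fin.cons (t • u) fun _ : Fin (n + 1) => t • u + τ • d)) 0 e =
      t * u e + τ * d e *
        ((n + 1) * Real.exp (-((t - 2 * τ) ^ 2 * ∑ m, a m ^ 2)) /
          (Real.exp (-(t ^ 2 * ∑ m, a m ^ 2)) +
            (n + 1) * Real.exp (-((t - 2 * τ) ^ 2 * ∑ m, a m ^ 2)))) := by
  have h0 : ∑ m, ((WQᵀ *ᵥ (t • u)) m - (WKᵀ *ᵥ (t • u)) m) ^ 2 = t ^ 2 * ∑ m, a m ^ 2 := by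
    rw [Finset.mul_sum]
    refine Finset.sum_congr rfl fun m _ => ?_
    simp only [← ha, mulVec_smul, Pi.smul_apply, Pi.sub_apply, smul_eq_mul]
    ring
  have h1 : ∑ m, ((WQᵀ *ᵥ (t • u)) m - (WKᵀ *ᵥ (t • u + τ • d)) m) ^ 2 =
      (t - 2 * τ) ^ 2 * ∑ m, a m ^ 2 := by
    rw [Finset.mul_sum]
    refine Finset.sum_congr rfl fun m _ => ?_
    simp only [mulVec_add, mulVec_smul, hd, Pi.add_apply, Pi.smul_apply, smul_eq_mul]
    simp only [← ha, Pi.sub_apply]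
    ring
  have hzero : Matrix.of (Fin.cons (t • u) fun _ : Fin (n + 1) => t • u + τ • d) 0 = t • u := rfl
  have hsucc (j : Fin (n + 1)) :
      Matrix.of (Fin.cons (t • u) fun _ : Fin (n + 1) => t • u + τ • d) j.succ = t • u + τ • d :=
    rfl
  rw [l2AttnUntied, Matrix.of_apply]
  simp only [Fin.sum_univ_succ (n := n + 1), hzero, hsucc, h0, h1, Finset.sum_const, Finset.card_univ, Fintype.card_fin, nsmul_eq_mul,
    Pi.add_apply, Pi.smul_apply, smul_eq_mul]
  have h2 := Real.exp_pos (-(t ^ 2 * ∑ m, a m ^ 2))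
  have h3 := Real.exp_pos (-((t - 2 * τ) ^ 2 * ∑ m, a m ^ 2))
  push_cast
  field_simp
  ring

/-- L2 self-attention with untied query/key weights (`WQ ≠ WK`, `WK` of full
column rank) is not Lipschitz with respect to the Frobenius norm. -/
theorem l2_attention_untied_not_lipschitz
    (N D D' : ℕ) (hN : 2 ≤ N) (hD : 1 ≤ D) (hD' : 1 ≤ D')
    (WQ WK : Matrix (Fin D) (Fin D') ℝ)
    (hne : WQ ≠ WK) (hWK : WK.rank = D') :
    ¬ ∃ K : ℝ, 0 ≤ K ∧ ∀ X X' : Matrix (Fin N) (Fin D) ℝ,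
      frobNorm (l2AttnUntied WQ WK X - l2AttnUntied WQ WK X') ≤
        K * frobNorm (X - X') := by
  rintro ⟨K, -, hK⟩
  obtain ⟨n, rfl⟩ : ∃ n, N = n + 1 + 1 := ⟨N - 2, by omega⟩
  obtain ⟨u, hu⟩ : ∃ u, WQᵀ *ᵥ u - WKᵀ *ᵥ u ≠ 0 := by
    by_contra! h
    exact hne (Matrix.transpose_injective
      (Matrix.mulVec_injective (funext fun u => sub_eq_zero.mp (h u))))
  set a := WQᵀ *ᵥ u - WKᵀ *ᵥ u with ha
  obtain ⟨d, hd⟩ := mulVec_surjective_of_rank_eq ((rank_transpose WK).trans hWK) ((2 : ℝ) • a)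
  obtain ⟨e, he⟩ : ∃ e, d e ≠ 0 := by
    by_contra! h
    rw [show d = 0 from funext h, mulVec_zero] at hd
    exact hu ((smul_eq_zero.mp hd.symm).resolve_left two_ne_zero)
  have hA : 0 < ∑ m, a m ^ 2 := by
    obtain ⟨m, hm⟩ := Function.ne_iff.mp hu
    exact Finset.sum_pos' (fun _ _ => sq_nonneg _) ⟨m, Finset.mem_univ m, sq_pos_of_ne_zero hm⟩
  have hout := l2AttnUntied_cons_zero_apply (n := n) WQ WK u d a ha.symm hd
  set A := ∑ m, a m ^ 2
  let X (t τ : ℝ) : Matrix (Fin (n + 1 + 1)) (Fin D) ℝ :=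
    Matrix.of (Fin.cons (t • u) fun _ => t • u + τ • d)
  let E : Matrix (Fin (n + 1 + 1)) (Fin D) ℝ := Matrix.of (Fin.cons 0 fun _ => -d)
  have hdiff (t : ℝ) : X t t - X t (t + 1) = E := by
    ext i j
    refine Fin.cases ?_ (fun i => ?_) i
    · simp [X, E]
    · simp [X, E]
      ring
  have key (t : ℝ) (ht : 0 ≤ t) :
      (t * ((n + 1) / (n + 2)) - (n + 1) / (4 * A)) * |d e| ≤ K * frobNorm E := by
    have h := (abs_apply_le_frobNorm _ 0 e).trans (hK (X t t) (X t (t + 1)))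
    rw [hdiff, Matrix.sub_apply, hout, hout] at h
    refine le_trans ?_ h
    set r := Real.exp (-(4 * (t + 1) * A)) with hr
    have hr0 : 0 < r := Real.exp_pos _
    have hsplit : Real.exp (-((t - 2 * (t + 1)) ^ 2 * A)) = Real.exp (-(t ^ 2 * A)) * r := by
      rw [hr, ← Real.exp_add]
      ring_nf
    have hrle : (t + 1) * r ≤ 1 / (4 * A) := by
      rw [le_div_iff₀ (by positivity)]
      have h1 : 4 * (t + 1) * A ≤ Real.exp (4 * (t + 1) * A) := by
        linarith [Real.add_one_le_exp (4 * (t + 1) * A)]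
      calc (t + 1) * r * (4 * A) = 4 * (t + 1) * A * r := by ring
        _ ≤ Real.exp (4 * (t + 1) * A) * r := by gcongr
        _ = 1 := by rw [hr, ← Real.exp_add, add_neg_cancel, Real.exp_zero]
    have hx := Real.exp_pos (-(t ^ 2 * A))
    rw [hsplit, show t - 2 * t = -t by ring, neg_sq]
    set x := Real.exp (-(t ^ 2 * A))
    have hbal : ((n : ℝ) + 1) * x / (x + (n + 1) * x) = (n + 1) / (n + 2) := by
      field_simp
      ring
    have hfar : ((n : ℝ) + 1) * (x * r) / (x + (n + 1) * (x * r)) ≤ (n + 1) * r := by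
      rw [div_le_iff₀ (by positivity)]
      have : 0 ≤ ((n : ℝ) + 1) * r * ((n + 1) * (x * r)) := by positivity
      linarith
    rw [hbal]
    set p := ((n : ℝ) + 1) * (x * r) / (x + (n + 1) * (x * r))
    have hp : (t + 1) * p ≤ (n + 1) / (4 * A) :=
      calc (t + 1) * p ≤ (t + 1) * ((n + 1) * r) := by gcongr
        _ = (n + 1) * ((t + 1) * r) := by ring
        _ ≤ (n + 1) * (1 / (4 * A)) := by gcongr
        _ = (n + 1) / (4 * A) := by ring
    rw [show t * u e + t * d e * ((n + 1) / (n + 2)) - (t * u e + (t + 1) * d e * p) =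
      (t * ((n + 1) / (n + 2)) - (t + 1) * p) * d e by ring, abs_mul]
    gcongr
    exact le_trans (by linarith) (le_abs_self _)
  have hlim : Filter.Tendsto
      (fun t : ℝ => (t * (((n : ℝ) + 1) / (n + 2)) - (n + 1) / (4 * A)) * |d e|)
      Filter.atTop Filter.atTop :=
    (Filter.tendsto_atTop_add_const_right _ _
      (Filter.tendsto_id.atTop_mul_const (by positivity))).atTop_mul_const (abs_pos.mpr he)
  obtain ⟨t, ht0, ht⟩ :=
    ((Filter.eventually_ge_atTop 0).and (hlim.eventually_gt_atTop (K * frobNorm E))).exists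
  exact (key t ht0).not_gt ht
end

section
/- L2 multihead self-attention F is Lipschitz with respect to the ℓ∞ norm, with Lipschitz constant at most (4c + 1/√D') · ‖W^{O⊤}‖_∞ · (max_h ‖W^{Q,h}‖_∞ ‖W^{Q,h⊤}‖_∞) · (max_h ‖W^{V,h⊤}‖_∞). That is, for all X, X' ∈ ℝ^{N×D}, max_{i,d} |F(X)_{id} − F(X')_{id}| ≤ (4c + 1/√D') ‖W^{O⊤}‖_∞ (max_h ‖W^{Q,h}‖_∞ ‖W^{Q,h⊤}‖_∞) (max_h ‖W^{V,h⊤}‖_∞) · max_{i,d} |X_{id} − X'_{id}|. -/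
open Matrix BigOperators

/-- ℓ∞ norm of a matrix viewed as a vector: the maximum absolute entry. -/
noncomputable def maxEntry {m n : Type*} [Fintype m] [Fintype n] (M : Matrix m n ℝ) : ℝ :=
  ⨆ i, ⨆ j, |M i j|

/-- The operator norm induced by the vector ℓ∞ norm: the maximum absolute row sum. -/
noncomputable def maxRowSum {m n : Type*} [Fintype m] [Fintype n] (M : Matrix m n ℝ) : ℝ :=
  ⨆ i, ∑ j, |M i j|

/-- A single head of L2 self-attention with tied query/key weights:
`f(X) = P X A` where `P i j ∝ exp(−‖WQᵀ(xᵢ − xⱼ)‖₂²/√D')` and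
`A = WQ WQᵀ / √D'`. -/
noncomputable def l2Head {N D D' : ℕ} (WQ : Matrix (Fin D) (Fin D') ℝ)
    (X : Matrix (Fin N) (Fin D) ℝ) : Matrix (Fin N) (Fin D) ℝ :=
  (Matrix.of fun i j =>
    Real.exp (-(∑ m, (WQᵀ.mulVec (X i - X j) m) ^ 2) / Real.sqrt D') /
      ∑ k, Real.exp (-(∑ m, (WQᵀ.mulVec (X i - X k) m) ^ 2) / Real.sqrt D')) *
    X * ((Real.sqrt D')⁻¹ • (WQ * WQᵀ))

/-- L2 multihead self-attention with `H` heads of width `D' = D/H`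
(so `D = H * D'`): `F(X) = [f¹(X)W^{V,1}, …, f^H(X)W^{V,H}] W^O`. -/
noncomputable def l2MHA {N H D' : ℕ}
    (WQ WV : Fin H → Matrix (Fin (H * D')) (Fin D') ℝ)
    (WO : Matrix (Fin (H * D')) (Fin (H * D')) ℝ)
    (X : Matrix (Fin N) (Fin (H * D')) ℝ) : Matrix (Fin N) (Fin (H * D')) ℝ :=
  (Matrix.of fun i d =>
    (l2Head (WQ (finProdFinEquiv.symm d).1) X * WV (finProdFinEquiv.symm d).1) i
      (finProdFinEquiv.symm d).2) * WO

lemma abs_le_maxEntry {m n : Type*} [Fintype m] [Fintype n] (M : Matrix m n ℝ) (i : m) (j : n) :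
    |M i j| ≤ maxEntry M :=
  (le_ciSup (f := fun j => |M i j|) (Set.finite_range _).bddAbove j).trans
    (le_ciSup (f := fun i => ⨆ j, |M i j|) (Set.finite_range _).bddAbove i)

lemma maxEntry_le {m n : Type*} [Fintype m] [Fintype n] {M : Matrix m n ℝ} {C : ℝ} (hC : 0 ≤ C)
    (h : ∀ i j, |M i j| ≤ C) : maxEntry M ≤ C :=
  Real.iSup_le (fun i => Real.iSup_le (h i) hC) hC

lemma maxEntry_nonneg {m n : Type*} [Fintype m] [Fintype n] (M : Matrix m n ℝ) :
    0 ≤ maxEntry M :=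
  Real.iSup_nonneg fun _ => Real.iSup_nonneg fun _ => abs_nonneg _

lemma sum_abs_le_maxRowSum {m n : Type*} [Fintype m] [Fintype n] (M : Matrix m n ℝ) (i : m) :
    ∑ j, |M i j| ≤ maxRowSum M :=
  le_ciSup (f := fun i => ∑ j, |M i j|) (Set.finite_range _).bddAbove i

lemma maxRowSum_nonneg {m n : Type*} [Fintype m] [Fintype n] (M : Matrix m n ℝ) :
    0 ≤ maxRowSum M :=
  Real.iSup_nonneg fun _ => Finset.sum_nonneg fun _ _ => abs_nonneg _

lemma abs_sum_mul_le {m n : Type*} [Fintype m] [Fintype n] (u : m → ℝ) (B : Matrix m n ℝ) (j : n)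
    {C : ℝ} (hC : 0 ≤ C) (hu : ∀ k, |u k| ≤ C) : |∑ k, u k * B k j| ≤ C * maxRowSum Bᵀ := by
  calc |∑ k, u k * B k j| ≤ ∑ k, |u k * B k j| := Finset.abs_sum_le_sum_abs _ _
    _ ≤ ∑ k, C * |B k j| := by
        refine Finset.sum_le_sum fun k _ => ?_
        rw [abs_mul]
        exact mul_le_mul_of_nonneg_right (hu k) (abs_nonneg _)
    _ = C * ∑ k, |Bᵀ j k| := by simp [Finset.mul_sum]
    _ ≤ C * maxRowSum Bᵀ := mul_le_mul_of_nonneg_left (sum_abs_le_maxRowSum Bᵀ j) hC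

lemma maxEntry_mul_le {l m n : Type*} [Fintype l] [Fintype m] [Fintype n]
    (M : Matrix l m ℝ) (B : Matrix m n ℝ) :
    maxEntry (M * B) ≤ maxEntry M * maxRowSum Bᵀ :=
  maxEntry_le (mul_nonneg (maxEntry_nonneg _) (maxRowSum_nonneg _)) fun i j =>
    abs_sum_mul_le (M i) B j (maxEntry_nonneg _) (abs_le_maxEntry M i)

/-- A Gibbs average of nonnegative energies, one of which vanishes, is at most `c`, where
`c * exp (c + 1)` is the number of the remaining energies. -/
lemma sum_mul_exp_neg_le {ι : Type*} [Fintype ι] (e : ι → ℝ) (i : ι) (hi : e i = 0)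
    {c : ℝ} (hc : c * Real.exp (c + 1) = (Fintype.card ι : ℝ) - 1) :
    ∑ k, Real.exp (-e k) * e k ≤ c * ∑ k, Real.exp (-e k) := by
  classical
  have key (x : ℝ) : Real.exp (-x) * (x - c) ≤ Real.exp (-(c + 1)) := by
    have h := Real.add_one_le_exp (x - c - 1)
    calc Real.exp (-x) * (x - c) ≤ Real.exp (-x) * Real.exp (x - c - 1) := by
          gcongr; linarith
      _ = Real.exp (-(c + 1)) := by rw [← Real.exp_add]; ring_nf
  have hsum : ∑ k ∈ Finset.univ.erase i, Real.exp (-e k) * (e k - c)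
      ≤ ((Fintype.card ι : ℝ) - 1) * Real.exp (-(c + 1)) := by
    refine (Finset.sum_le_card_nsmul _ _ _ fun k _ => key (e k)).trans_eq ?_
    rw [Finset.card_erase_of_mem (Finset.mem_univ i), Finset.card_univ, nsmul_eq_mul,
      Nat.cast_pred (Fintype.card_pos_iff.2 ⟨i⟩)]
  rw [← hc, mul_assoc, ← Real.exp_add, add_neg_cancel, Real.exp_zero, mul_one] at hsum
  have hsplit := Finset.add_sum_erase Finset.univ (fun k => Real.exp (-e k) * (e k - c))
    (Finset.mem_univ i)
  have htot : ∑ k, Real.exp (-e k) * (e k - c)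
      = ∑ k, Real.exp (-e k) * e k - c * ∑ k, Real.exp (-e k) := by
    rw [Finset.mul_sum, ← Finset.sum_sub_distrib]
    exact Finset.sum_congr rfl fun k _ => by ring
  simp only [hi, neg_zero, Real.exp_zero] at hsplit
  linarith

/-- The weighted mean minimizes the weighted sum of squared deviations. -/
lemma sum_mul_sq_sub_mean_le {ι : Type*} [Fintype ι] (w y : ι → ℝ) (hw : 0 < ∑ k, w k) (b : ℝ) :
    ∑ k, w k * (y k - (∑ k, w k * y k) / ∑ k, w k) ^ 2 ≤ ∑ k, w k * (y k - b) ^ 2 := by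
  set g := (∑ k, w k * y k) / ∑ k, w k with hg
  have hS : ∑ k, w k * y k = g * ∑ k, w k := by rw [hg, div_mul_cancel₀ _ hw.ne']
  have h : ∑ k, w k * (y k - b) ^ 2
      = ∑ k, w k * (y k - g) ^ 2 + (g - b) ^ 2 * ∑ k, w k := by
    have h0 : ∑ k, w k * (y k - b) ^ 2 = ∑ k, w k * (y k - g) ^ 2
        + 2 * (g - b) * (∑ k, w k * y k) - (g - b) * (g + b) * ∑ k, w k := by
      simp only [Finset.mul_sum, ← Finset.sum_add_distrib, ← Finset.sum_sub_distrib]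
      exact Finset.sum_congr rfl fun k _ => by ring
    rw [h0, hS]; ring
  rw [h]
  exact le_add_of_nonneg_right (mul_nonneg (sq_nonneg _) hw.le)

lemma sum_abs_le_sqrt_card_mul {κ : Type*} [Fintype κ] (z : κ → ℝ) :
    ∑ m, |z m| ≤ Real.sqrt (Fintype.card κ) * Real.sqrt (∑ m, z m ^ 2) := by
  rw [← Real.sqrt_mul (Nat.cast_nonneg _)]
  apply Real.le_sqrt_of_sq_le
  simpa using sq_sum_le_card_mul_sum_sq (s := Finset.univ) (f := fun m => |z m|)

/-- Unnormalized L2 attention weight of token `k` as seen from token `i`. -/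
noncomputable def l2Weight {ι κ : Type*} [Fintype κ] (Y : ι → κ → ℝ) (i k : ι) : ℝ :=
  Real.exp (-(∑ m, (Y i m - Y k m) ^ 2) / Real.sqrt (Fintype.card κ))

lemma l2Weight_pos {ι κ : Type*} [Fintype κ] (Y : ι → κ → ℝ) (i k : ι) : 0 < l2Weight Y i k :=
  Real.exp_pos _

lemma sum_l2Weight_pos {ι κ : Type*} [Fintype ι] [Fintype κ] (Y : ι → κ → ℝ) (i : ι) :
    0 < ∑ k, l2Weight Y i k :=
  Finset.sum_pos (fun _ _ => l2Weight_pos _ _ _) ⟨i, Finset.mem_univ i⟩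

/-- The attention average of the tokens seen from token `i`, in coordinate `a`. -/
noncomputable def l2Average {ι κ : Type*} [Fintype ι] [Fintype κ] (Y : ι → κ → ℝ) (i : ι) (a : κ) :
    ℝ :=
  (∑ k, l2Weight Y i k * Y k a) / ∑ k, l2Weight Y i k

lemma sum_l2Weight_mul_sq_le {ι κ : Type*} [Fintype ι] [Fintype κ] [Nonempty κ] (Y : ι → κ → ℝ)
    (i : ι) {c : ℝ} (hc : c * Real.exp (c + 1) = (Fintype.card ι : ℝ) - 1) :
    ∑ k, l2Weight Y i k * ∑ m, (Y i m - Y k m) ^ 2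
      ≤ c * Real.sqrt (Fintype.card κ) * ∑ k, l2Weight Y i k := by
  have hs : 0 < Real.sqrt (Fintype.card κ) := Real.sqrt_pos.2 (by exact_mod_cast Fintype.card_pos)
  set s := Real.sqrt (Fintype.card κ) with hsdef
  have h := sum_mul_exp_neg_le (fun k => (∑ m, (Y i m - Y k m) ^ 2) / s) i (by simp) hc
  have hw (k : ι) : Real.exp (-((∑ m, (Y i m - Y k m) ^ 2) / s)) = l2Weight Y i k := by
    rw [l2Weight, neg_div]
  simp only [hw, ← mul_div_assoc, ← Finset.sum_div] at h
  rw [div_le_iff₀ hs] at h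
  linarith

/-- Bound on the directional derivative of `l2Average` (multiplied by the total weight). -/
lemma abs_l2Average_deriv_le {ι κ : Type*} [Fintype ι] [Fintype κ] [Nonempty κ]
    (Y V : ι → κ → ℝ) (i : ι) (a : κ) {c δ : ℝ}
    (hc : c * Real.exp (c + 1) = (Fintype.card ι : ℝ) - 1) (hV : ∀ k m, |V k m| ≤ δ) :
    |∑ k, (l2Weight Y i k * (-(∑ m, 2 * (Y i m - Y k m) * (V i m - V k m)) /
          Real.sqrt (Fintype.card κ)) * (Y k a - l2Average Y i a) + l2Weight Y i k * V k a)|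
      ≤ (4 * c * Real.sqrt (Fintype.card κ) + 1) * δ * ∑ k, l2Weight Y i k := by
  have hδ : 0 ≤ δ := (abs_nonneg _).trans (hV i a)
  have hs : 0 < Real.sqrt (Fintype.card κ) := Real.sqrt_pos.2 (by exact_mod_cast Fintype.card_pos)
  have hE := sum_l2Weight_mul_sq_le Y i hc
  have hvar := sum_mul_sq_sub_mean_le (fun k => l2Weight Y i k) (fun k => Y k a)
    (sum_l2Weight_pos Y i) (Y i a)
  change ∑ k, l2Weight Y i k * (Y k a - l2Average Y i a) ^ 2 ≤ _ at hvar
  have hvar' : ∑ k, l2Weight Y i k * (Y k a - Y i a) ^ 2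
      ≤ ∑ k, l2Weight Y i k * ∑ m, (Y i m - Y k m) ^ 2 := by
    refine Finset.sum_le_sum fun k _ => mul_le_mul_of_nonneg_left ?_ (l2Weight_pos _ _ _).le
    rw [← neg_sub, neg_sq]
    exact Finset.single_le_sum (f := fun m => (Y i m - Y k m) ^ 2) (fun m _ => sq_nonneg _)
      (Finset.mem_univ a)
  have hr (k : ι) : |-(∑ m, 2 * (Y i m - Y k m) * (V i m - V k m)) /
      Real.sqrt (Fintype.card κ)| ≤ 4 * δ * Real.sqrt (∑ m, (Y i m - Y k m) ^ 2) := by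
    rw [abs_div, abs_neg, abs_of_pos hs, div_le_iff₀ hs]
    calc |∑ m, 2 * (Y i m - Y k m) * (V i m - V k m)|
        ≤ ∑ m, |2 * (Y i m - Y k m) * (V i m - V k m)| := Finset.abs_sum_le_sum_abs _ _
      _ ≤ ∑ m, 4 * δ * |Y i m - Y k m| := by
          refine Finset.sum_le_sum fun m _ => ?_
          have h1 : |V i m - V k m| ≤ 2 * δ :=
            (abs_sub _ _).trans (by linarith [hV i m, hV k m])
          rw [abs_mul, abs_mul, abs_two]
          nlinarith [abs_nonneg (Y i m - Y k m)]
      _ = 4 * δ * ∑ m, |Y i m - Y k m| := by rw [Finset.mul_sum]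
      _ ≤ 4 * δ * (Real.sqrt (Fintype.card κ) * Real.sqrt (∑ m, (Y i m - Y k m) ^ 2)) :=
          mul_le_mul_of_nonneg_left (sum_abs_le_sqrt_card_mul _) (by positivity)
      _ = _ := by ring
  have hterm (k : ι) : |l2Weight Y i k * (-(∑ m, 2 * (Y i m - Y k m) * (V i m - V k m)) /
          Real.sqrt (Fintype.card κ)) * (Y k a - l2Average Y i a) + l2Weight Y i k * V k a|
      ≤ 2 * δ * (l2Weight Y i k * ∑ m, (Y i m - Y k m) ^ 2)
        + 2 * δ * (l2Weight Y i k * (Y k a - l2Average Y i a) ^ 2) + δ * l2Weight Y i k := by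
    have hw := l2Weight_pos Y i k
    have hq : 0 ≤ ∑ m, (Y i m - Y k m) ^ 2 := Finset.sum_nonneg fun _ _ => sq_nonneg _
    have hsq := Real.sq_sqrt hq
    refine (abs_add_le _ _).trans (add_le_add ?_ ?_)
    · rw [abs_mul, abs_mul, abs_of_pos hw]
      set ρ := Real.sqrt (∑ m, (Y i m - Y k m) ^ 2)
      rw [← hsq, ← sq_abs (Y k a - l2Average Y i a)]
      set u := |Y k a - l2Average Y i a|
      calc _ ≤ l2Weight Y i k * (4 * δ * ρ) * u := by
            gcongr
            exact hr k
        _ ≤ _ := by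
            nlinarith [mul_nonneg (mul_nonneg hδ hw.le) (sq_nonneg (ρ - u))]
    · rw [abs_mul, abs_of_pos hw, mul_comm]
      exact mul_le_mul_of_nonneg_right (hV k a) hw.le
  refine (Finset.abs_sum_le_sum_abs _ _).trans ((Finset.sum_le_sum fun k _ => hterm k).trans ?_)
  rw [Finset.sum_add_distrib, Finset.sum_add_distrib, ← Finset.mul_sum, ← Finset.mul_sum,
    ← Finset.mul_sum]
  nlinarith [mul_le_mul_of_nonneg_left hE hδ, mul_le_mul_of_nonneg_left hvar hδ,
    mul_le_mul_of_nonneg_left hvar' hδ]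

lemma hasDerivAt_l2Average {ι κ : Type*} [Fintype ι] [Fintype κ]
    (Y V : ι → κ → ℝ) (i : ι) (a : κ) (t : ℝ) :
    HasDerivAt (fun t : ℝ => l2Average (Y + t • V) i a)
      ((∑ k, (l2Weight (Y + t • V) i k *
          (-(∑ m, 2 * ((Y + t • V) i m - (Y + t • V) k m) * (V i m - V k m)) /
          Real.sqrt (Fintype.card κ)) * ((Y + t • V) k a - l2Average (Y + t • V) i a)
            + l2Weight (Y + t • V) i k * V k a)) / ∑ k, l2Weight (Y + t • V) i k) t := by
  have hY (k : ι) (m : κ) : HasDerivAt (fun t : ℝ => (Y + t • V) k m) (V k m) t := by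
    simpa using ((hasDerivAt_id t).mul_const (V k m)).const_add (Y k m)
  have hw (k : ι) : HasDerivAt (fun t : ℝ => l2Weight (Y + t • V) i k)
      (l2Weight (Y + t • V) i k *
          (-(∑ m, 2 * ((Y + t • V) i m - (Y + t • V) k m) * (V i m - V k m)) /
          Real.sqrt (Fintype.card κ))) t := by
    refine HasDerivAt.exp (HasDerivAt.div_const (HasDerivAt.fun_neg ?_) _)
    refine HasDerivAt.fun_sum fun m _ => ?_
    simpa using ((hY i m).fun_sub (hY k m)).fun_pow 2
  have hpos := sum_l2Weight_pos (Y + t • V) i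
  have h := (HasDerivAt.fun_sum fun k (_ : k ∈ Finset.univ) => (hw k).mul (hY k a)).div
    (HasDerivAt.fun_sum fun k (_ : k ∈ Finset.univ) => hw k) hpos.ne'
  refine h.congr_deriv ?_
  have hS : ∑ k, l2Weight (Y + t • V) i k * (Y + t • V) k a
      = l2Average (Y + t • V) i a * ∑ k, l2Weight (Y + t • V) i k := by
    rw [l2Average, div_mul_cancel₀ _ hpos.ne']
  simp only [Pi.mul_apply] at *
  rw [hS, div_eq_div_iff (pow_ne_zero 2 hpos.ne') hpos.ne']
  simp only [mul_sub, Finset.sum_add_distrib, Finset.sum_sub_distrib, ← Finset.sum_mul]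
  ring

lemma abs_l2Average_sub_le {ι κ : Type*} [Fintype ι] [Fintype κ] [Nonempty κ]
    (Y Y' : ι → κ → ℝ) (i : ι) (a : κ) {c δ : ℝ}
    (hc : c * Real.exp (c + 1) = (Fintype.card ι : ℝ) - 1)
    (hY : ∀ k m, |Y k m - Y' k m| ≤ δ) :
    |l2Average Y i a - l2Average Y' i a| ≤ (4 * c * Real.sqrt (Fintype.card κ) + 1) * δ := by
  have h := norm_image_sub_le_of_norm_deriv_le_segment_01'
    (f := fun t : ℝ => l2Average (Y' + t • (Y - Y')) i a)
    (C := (4 * c * Real.sqrt (Fintype.card κ) + 1) * δ)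
    (fun t _ => (hasDerivAt_l2Average Y' (Y - Y') i a t).hasDerivWithinAt)
    (fun t _ => by
      have hpos := sum_l2Weight_pos (Y' + t • (Y - Y')) i
      rw [Real.norm_eq_abs, abs_div, abs_of_pos hpos, div_le_iff₀ hpos]
      exact abs_l2Average_deriv_le _ _ i a hc hY)
  simpa using h

lemma l2Head_apply {N D D' : ℕ} (WQ : Matrix (Fin D) (Fin D') ℝ) (X : Matrix (Fin N) (Fin D) ℝ)
    (i : Fin N) (d : Fin D) :
    l2Head WQ X i d = (Real.sqrt D')⁻¹ * ∑ a, l2Average (X * WQ) i a * WQᵀ a d := by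
  have hz (j k : Fin N) (m : Fin D') :
      (WQᵀ *ᵥ (X j - X k)) m = (X * WQ) j m - (X * WQ) k m := by
    rw [mulVec_transpose, sub_vecMul]
    rfl
  rw [l2Head, Matrix.mul_smul, ← Matrix.mul_assoc, Matrix.mul_assoc _ X WQ, Matrix.smul_apply,
    smul_eq_mul, Matrix.mul_apply]
  congr 1
  refine Finset.sum_congr rfl fun a _ => ?_
  unfold l2Average
  rw [Matrix.mul_apply, Finset.sum_div]
  congr 1
  refine Finset.sum_congr rfl fun k _ => ?_
  simp only [Matrix.of_apply, hz, l2Weight, Fintype.card_fin]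
  ring

lemma maxEntry_l2Head_sub_le {N D D' : ℕ} (hD' : 1 ≤ D') (WQ : Matrix (Fin D) (Fin D') ℝ)
    {c : ℝ} (hc0 : 0 ≤ c) (hc : c * Real.exp (c + 1) = (N : ℝ) - 1)
    (X X' : Matrix (Fin N) (Fin D) ℝ) :
    maxEntry (l2Head WQ X - l2Head WQ X') ≤
      (4 * c + 1 / Real.sqrt D') * (maxRowSum WQ * maxRowSum WQᵀ) * maxEntry (X - X') := by
  have : Nonempty (Fin D') := ⟨⟨0, hD'⟩⟩
  have hs : 0 < Real.sqrt D' := Real.sqrt_pos.2 (by exact_mod_cast hD')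
  have h1 := maxRowSum_nonneg WQ
  have h2 := maxRowSum_nonneg WQᵀ
  have h3 := maxEntry_nonneg (X - X')
  refine maxEntry_le (by positivity) fun i d => ?_
  have hδ (k : Fin N) (m : Fin D') :
      |(X * WQ) k m - (X' * WQ) k m| ≤ maxEntry (X - X') * maxRowSum WQᵀ := by
    rw [← Matrix.sub_apply, ← Matrix.sub_mul]
    exact (abs_le_maxEntry _ k m).trans (maxEntry_mul_le _ _)
  have hu (a : Fin D') := abs_l2Average_sub_le (X * WQ) (X' * WQ) i a (c := c)
    (by simpa using hc) hδ
  have h := abs_sum_mul_le (fun a => l2Average (X * WQ) i a - l2Average (X' * WQ) i a) WQᵀ d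
    (by positivity) hu
  rw [Matrix.transpose_transpose, Fintype.card_fin] at h
  rw [Matrix.sub_apply, l2Head_apply, l2Head_apply, ← mul_sub, ← Finset.sum_sub_distrib, abs_mul,
    abs_of_pos (inv_pos.2 hs)]
  simp only [sub_mul] at h
  refine (mul_le_mul_of_nonneg_left h (inv_pos.2 hs).le).trans_eq ?_
  field_simp

/-- L2 multihead self-attention is Lipschitz w.r.t. the ℓ∞ norm, with constant
at most `(4c + 1/√D') ‖WOᵀ‖_∞ (max_h ‖WQₕ‖_∞‖WQₕᵀ‖_∞)(max_h ‖WVₕᵀ‖_∞)`,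
where `c·exp(c+1) = N − 1`. -/
theorem l2MHA_lipschitz_inf
    (N H D' : ℕ) (hN : 2 ≤ N) (hH : 1 ≤ H) (hD' : 1 ≤ D')
    (WQ WV : Fin H → Matrix (Fin (H * D')) (Fin D') ℝ)
    (WO : Matrix (Fin (H * D')) (Fin (H * D')) ℝ)
    (c : ℝ) (hc0 : 0 ≤ c) (hc : c * Real.exp (c + 1) = (N : ℝ) - 1) :
    ∀ X X' : Matrix (Fin N) (Fin (H * D')) ℝ,
      maxEntry (l2MHA WQ WV WO X - l2MHA WQ WV WO X') ≤
        (4 * c + 1 / Real.sqrt D') * maxRowSum WOᵀ *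
          (⨆ h, maxRowSum (WQ h) * maxRowSum (WQ h)ᵀ) *
          (⨆ h, maxRowSum (WV h)ᵀ) * maxEntry (X - X') := by
  intro X X'
  set K := 4 * c + 1 / Real.sqrt D' with hK
  set Q := ⨆ h, maxRowSum (WQ h) * maxRowSum (WQ h)ᵀ with hQ
  set V := ⨆ h, maxRowSum (WV h)ᵀ with hV
  have hK0 : 0 ≤ K := by positivity
  have hQ0 : 0 ≤ Q :=
    Real.iSup_nonneg fun h => mul_nonneg (maxRowSum_nonneg _) (maxRowSum_nonneg _)
  have hV0 : 0 ≤ V := Real.iSup_nonneg fun h => maxRowSum_nonneg _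
  have hX0 := maxEntry_nonneg (X - X')
  rw [l2MHA, l2MHA, ← Matrix.sub_mul]
  refine (maxEntry_mul_le _ _).trans ?_
  have hB : ∀ h, maxEntry (l2Head (WQ h) X * WV h - l2Head (WQ h) X' * WV h)
      ≤ K * Q * maxEntry (X - X') * V := by
    intro h
    rw [← Matrix.sub_mul]
    refine (maxEntry_mul_le _ _).trans (mul_le_mul ?_ ?_ (maxRowSum_nonneg _) (by positivity))
    · refine (maxEntry_l2Head_sub_le hD' (WQ h) hc0 hc X X').trans ?_
      gcongr
      exact le_ciSup (f := fun h => maxRowSum (WQ h) * maxRowSum (WQ h)ᵀ)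
        (Set.finite_range _).bddAbove h
    · exact le_ciSup (f := fun h => maxRowSum (WV h)ᵀ) (Set.finite_range _).bddAbove h
  calc _ ≤ K * Q * maxEntry (X - X') * V * maxRowSum WOᵀ := by
        refine mul_le_mul_of_nonneg_right (maxEntry_le (by positivity) fun i d => ?_)
          (maxRowSum_nonneg _)
        exact (abs_le_maxEntry _ i (finProdFinEquiv.symm d).2).trans
          (hB (finProdFinEquiv.symm d).1)
    _ = _ := by ring
end

section
/- A single head of L2 self-attention with tied query and key weights is Lipschitz with respect to the ℓ2 (Frobenius) norm, with Lipschitz constant at most (√N ‖W^Q‖₂² / √D') (4c + 1). That is, for all X, X' ∈ ℝ^{N×D}, ‖f(X) − f(X')‖_F ≤ (√N ‖W^Q‖₂² / √D') (4c + 1) · ‖X − X'‖_F. -/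
open Matrix BigOperators

/-- Spectral norm (operator norm induced by the Euclidean vector norm):
`sup_{‖x‖₂ = 1} ‖M x‖₂`. -/
noncomputable def specNorm {m n : Type*} [Fintype m] [Fintype n]
    (M : Matrix m n ℝ) : ℝ :=
  sSup {r : ℝ | ∃ x : n → ℝ, Real.sqrt (∑ j, x j ^ 2) = 1 ∧
    r = Real.sqrt (∑ i, M.mulVec x i ^ 2)}

/-- The weighted mean of the `h k`, with the weight of `h k` proportional to `exp (-‖h i - h k‖²)`. -/
noncomputable def gaussianMean {ι H : Type*} [Fintype ι] [NormedAddCommGroup H]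
    [InnerProductSpace ℝ H] (i : ι) (h : ι → H) : H :=
  (∑ k, Real.exp (-‖h i - h k‖ ^ 2))⁻¹ • ∑ k, Real.exp (-‖h i - h k‖ ^ 2) • h k

lemma sub_mul_exp_neg_le (t c : ℝ) : (t - c) * Real.exp (-t) ≤ Real.exp (-(c + 1)) := by
  have h := Real.add_one_le_exp (t - c - 1)
  calc (t - c) * Real.exp (-t) ≤ Real.exp (t - c - 1) * Real.exp (-t) :=
        mul_le_mul_of_nonneg_right (by linarith) (Real.exp_pos _).le
    _ = Real.exp (-(c + 1)) := by rw [← Real.exp_add]; ring_nf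

/-- The mean of `t` under weights `exp (-t k)` is at most `c` if some `t i` vanishes. -/
lemma sum_exp_neg_mul_le {ι : Type*} [Fintype ι] {c : ℝ}
    (hc : c * Real.exp (c + 1) = (Fintype.card ι : ℝ) - 1) (t : ι → ℝ) (i : ι) (hi : t i = 0) :
    ∑ k, Real.exp (-t k) * t k ≤ c * ∑ k, Real.exp (-t k) := by
  classical
  have hrest : ∑ k ∈ Finset.univ.erase i, (t k - c) * Real.exp (-t k) ≤ c := by
    calc _ ≤ ∑ k ∈ Finset.univ.erase i, Real.exp (-(c + 1)) :=
          Finset.sum_le_sum fun k _ => sub_mul_exp_neg_le _ _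
      _ = ((Fintype.card ι : ℝ) - 1) * Real.exp (-(c + 1)) := by
          rw [Finset.sum_const, nsmul_eq_mul, Finset.card_erase_of_mem (Finset.mem_univ i),
            Finset.card_univ, Nat.cast_pred (Fintype.card_pos_iff.2 ⟨i⟩)]
      _ = c := by rw [← hc, mul_assoc, ← Real.exp_add]; simp
  have hall : ∑ k, (t k - c) * Real.exp (-t k) ≤ 0 := by
    rw [← Finset.add_sum_erase _ _ (Finset.mem_univ i), hi]
    simp only [zero_sub, neg_zero, Real.exp_zero, mul_one]
    linarith
  have hsplit : ∑ k, (t k - c) * Real.exp (-t k) =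
      ∑ k, Real.exp (-t k) * t k - c * ∑ k, Real.exp (-t k) := by
    rw [Finset.mul_sum, ← Finset.sum_sub_distrib]
    exact Finset.sum_congr rfl fun k _ => by ring
  linarith

/-- A weighted second moment is minimal around the weighted mean. -/
lemma sum_mul_norm_sub_sq_le {ι H : Type*} [Fintype ι] [NormedAddCommGroup H]
    [InnerProductSpace ℝ H] (w : ι → ℝ) (hw : ∀ k, 0 ≤ w k) (h : ι → H) (m b : H)
    (hm : ∑ k, w k • (h k - m) = 0) :
    ∑ k, w k * ‖h k - m‖ ^ 2 ≤ ∑ k, w k * ‖h k - b‖ ^ 2 := by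
  have hcross : ∑ k, w k * inner ℝ (h k - m) (m - b) = 0 := by
    simp_rw [← real_inner_smul_left]
    rw [← sum_inner, hm, inner_zero_left]
  have hexp : ∀ k, w k * ‖h k - b‖ ^ 2 = w k * ‖h k - m‖ ^ 2 +
      2 * (w k * inner ℝ (h k - m) (m - b)) + w k * ‖m - b‖ ^ 2 := fun k => by
    rw [← sub_add_sub_cancel (h k) m b, norm_add_sq_real]; ring
  simp_rw [hexp]
  rw [Finset.sum_add_distrib, Finset.sum_add_distrib, ← Finset.mul_sum, hcross]
  have := Finset.sum_nonneg fun k (_ : k ∈ Finset.univ) => mul_nonneg (hw k) (sq_nonneg ‖m - b‖)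
  linarith

lemma sum_exp_neg_norm_sq_pos {ι H : Type*} [Fintype ι] [NormedAddCommGroup H]
    (i : ι) (h : ι → H) :
    0 < ∑ k, Real.exp (-‖h i - h k‖ ^ 2) :=
  Finset.sum_pos (fun _ _ => Real.exp_pos _) ⟨i, Finset.mem_univ i⟩

section

variable {ι H : Type*} [Fintype ι] [NormedAddCommGroup H] [InnerProductSpace ℝ H]

lemma sum_exp_smul_sub_gaussianMean (i : ι) (h : ι → H) :
    ∑ k, Real.exp (-‖h i - h k‖ ^ 2) • (h k - gaussianMean i h) = 0 := by
  simp_rw [smul_sub]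
  rw [Finset.sum_sub_distrib, ← Finset.sum_smul, gaussianMean, smul_smul,
    mul_inv_cancel₀ (sum_exp_neg_norm_sq_pos i h).ne', one_smul, sub_self]

/-- The derivative of `gaussianMean` along a line. -/
lemma hasDerivAt_gaussianMean_line (i : ι) (h u : ι → H) (t : ℝ) :
    HasDerivAt (fun s : ℝ => gaussianMean i (h + s • u))
      ((∑ k, Real.exp (-‖(h + t • u) i - (h + t • u) k‖ ^ 2))⁻¹ •
        ∑ k, Real.exp (-‖(h + t • u) i - (h + t • u) k‖ ^ 2) •
          (u k + (-2 * inner ℝ ((h + t • u) i - (h + t • u) k) (u i - u k)) •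
            ((h + t • u) k - gaussianMean i (h + t • u)))) t := by
  have hline : ∀ k, HasDerivAt (fun s : ℝ => (h + s • u) k) (u k) t := fun k => by
    simpa using ((hasDerivAt_id t).smul_const (u k)).const_add (h k)
  have hexp : ∀ k, HasDerivAt (fun s : ℝ => Real.exp (-‖(h + s • u) i - (h + s • u) k‖ ^ 2))
      (Real.exp (-‖(h + t • u) i - (h + t • u) k‖ ^ 2) *
        (-2 * inner ℝ ((h + t • u) i - (h + t • u) k) (u i - u k))) t := fun k => by
    refine ((hline i).fun_sub (hline k)).norm_sq.fun_neg.exp.congr_deriv ?_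
    ring
  have hS := HasDerivAt.fun_sum fun k (_ : k ∈ Finset.univ) => hexp k
  have hV := HasDerivAt.fun_sum fun k (_ : k ∈ Finset.univ) => (hexp k).fun_smul (hline k)
  have hpos := sum_exp_neg_norm_sq_pos i (h + t • u)
  refine ((hS.fun_inv hpos.ne').fun_smul hV).congr_deriv ?_
  have hmean : ∑ k, Real.exp (-‖(h + t • u) i - (h + t • u) k‖ ^ 2) • (h + t • u) k =
      (∑ k, Real.exp (-‖(h + t • u) i - (h + t • u) k‖ ^ 2)) • gaussianMean i (h + t • u) := by
    rw [gaussianMean, smul_smul, mul_inv_cancel₀ hpos.ne', one_smul]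
  rw [hmean]
  simp_rw [smul_add, smul_sub, smul_smul]
  simp only [Finset.sum_add_distrib, Finset.sum_sub_distrib, ← Finset.sum_smul]
  generalize gaussianMean i (h + t • u) = m
  have hS0 := hpos.ne'
  simp only [smul_add, smul_sub, smul_smul]
  generalize hSg : (∑ k, Real.exp (-‖(h + t • u) i - (h + t • u) k‖ ^ 2)) = S at hS0
  match_scalars <;> field_simp
  exact congrArg _ (Finset.sum_congr rfl fun k _ => by ring)

/-- `gaussianMean` is Lipschitz for the supremum of the norms of the entries. -/
lemma norm_gaussianMean_sub_le {c : ℝ}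
    (hc : c * Real.exp (c + 1) = (Fintype.card ι : ℝ) - 1) (i : ι) (h h' : ι → H) {R : ℝ}
    (hR : ∀ k, ‖h k - h' k‖ ≤ R) :
    ‖gaussianMean i h - gaussianMean i h'‖ ≤ (4 * c + 1) * R := by
  have hR0 : 0 ≤ R := (norm_nonneg _).trans (hR i)
  have hbound : ∀ g : ι → H, ‖(∑ k, Real.exp (-‖g i - g k‖ ^ 2))⁻¹ •
        ∑ k, Real.exp (-‖g i - g k‖ ^ 2) •
          ((h - h') k + (-2 * inner ℝ (g i - g k) ((h - h') i - (h - h') k)) •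
            (g k - gaussianMean i g))‖ ≤ (4 * c + 1) * R := by
    intro g
    have hpos := sum_exp_neg_norm_sq_pos i g
    rw [norm_smul, norm_inv, Real.norm_of_nonneg hpos.le, inv_mul_le_iff₀ hpos]
    have hmoment := sum_exp_neg_mul_le hc (fun k => ‖g i - g k‖ ^ 2) i (by simp)
    have hvar := sum_mul_norm_sub_sq_le (fun k => Real.exp (-‖g i - g k‖ ^ 2))
      (fun k => (Real.exp_pos _).le) g (gaussianMean i g) (g i)
      (sum_exp_smul_sub_gaussianMean i g)
    simp_rw [fun k => norm_sub_rev (g k) (g i)] at hvar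
    have hterm : ∀ k, ‖Real.exp (-‖g i - g k‖ ^ 2) •
          ((h - h') k + (-2 * inner ℝ (g i - g k) ((h - h') i - (h - h') k)) •
            (g k - gaussianMean i g))‖ ≤
        R * Real.exp (-‖g i - g k‖ ^ 2) +
        2 * R * (Real.exp (-‖g i - g k‖ ^ 2) * ‖g i - g k‖ ^ 2) +
        2 * R * (Real.exp (-‖g i - g k‖ ^ 2) * ‖g k - gaussianMean i g‖ ^ 2) := by
      intro k
      have hinner : ‖-2 * inner ℝ (g i - g k) ((h - h') i - (h - h') k)‖ ≤
          4 * R * ‖g i - g k‖ := by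
        have h1 : ‖(h - h') i - (h - h') k‖ ≤ 2 * R := by
          refine (norm_sub_le _ _).trans ?_
          have := hR i
          have := hR k
          simp only [Pi.sub_apply]
          linarith
        rw [norm_mul, norm_neg, Real.norm_ofNat]
        have h2 := (norm_inner_le_norm (𝕜 := ℝ) (g i - g k) ((h - h') i - (h - h') k)).trans
          (mul_le_mul_of_nonneg_left h1 (norm_nonneg _))
        linarith
      have hsum : ‖(h - h') k + (-2 * inner ℝ (g i - g k) ((h - h') i - (h - h') k)) •
            (g k - gaussianMean i g)‖ ≤
          R + 2 * R * ‖g i - g k‖ ^ 2 + 2 * R * ‖g k - gaussianMean i g‖ ^ 2 := by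
        refine (norm_add_le _ _).trans ?_
        rw [norm_smul]
        have h1 := mul_le_mul_of_nonneg_right hinner (norm_nonneg (g k - gaussianMean i g))
        have h2 := mul_nonneg hR0 (sq_nonneg (‖g i - g k‖ - ‖g k - gaussianMean i g‖))
        have h3 : ‖(h - h') k‖ ≤ R := hR k
        nlinarith
      rw [norm_smul, Real.norm_of_nonneg (Real.exp_pos _).le]
      have := mul_le_mul_of_nonneg_left hsum (Real.exp_pos (-‖g i - g k‖ ^ 2)).le
      linarith
    refine (norm_sum_le_of_le _ fun k _ => hterm k).trans ?_
    rw [Finset.sum_add_distrib, Finset.sum_add_distrib, ← Finset.mul_sum, ← Finset.mul_sum,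
      ← Finset.mul_sum]
    have h1 := mul_le_mul_of_nonneg_left hmoment (mul_nonneg zero_le_two hR0)
    have h2 := mul_le_mul_of_nonneg_left (hvar.trans hmoment) (mul_nonneg zero_le_two hR0)
    linarith
  have hmv := convex_univ.norm_image_sub_le_of_norm_hasDerivWithin_le (x := (0 : ℝ)) (y := 1)
    (fun t _ => (hasDerivAt_gaussianMean_line i h' (h - h') t).hasDerivWithinAt)
    (fun t _ => hbound (h' + t • (h - h'))) (Set.mem_univ _) (Set.mem_univ _)
  simpa using hmv

end

section

variable {m n : Type*} [Fintype m] [Fintype n]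

lemma frobNorm_eq_sqrt_sum_norm_sq (M : Matrix m n ℝ) :
    frobNorm M = Real.sqrt (∑ i, ‖WithLp.toLp 2 (M i)‖ ^ 2) := by
  simp [frobNorm, EuclideanSpace.norm_sq_eq]

lemma specNorm_nonneg (M : Matrix m n ℝ) : 0 ≤ specNorm M := by
  refine Real.sSup_nonneg ?_
  rintro r ⟨x, -, rfl⟩
  exact Real.sqrt_nonneg _

lemma norm_toEuclideanLin_le_specNorm_mul [DecidableEq n] (M : Matrix m n ℝ) (x : EuclideanSpace ℝ n) :
    ‖Matrix.toEuclideanLin M x‖ ≤ specNorm M * ‖x‖ := by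
  rcases eq_or_ne x 0 with rfl | hx
  · simp
  have hnorm : ∀ y : n → ℝ, Real.sqrt (∑ j, y j ^ 2) = ‖WithLp.toLp 2 y‖ := fun y => by
    simp [EuclideanSpace.norm_eq]
  have himage : ∀ y : n → ℝ, Real.sqrt (∑ i, M.mulVec y i ^ 2) =
      ‖Matrix.toEuclideanLin M (WithLp.toLp 2 y)‖ := fun y => by
    simp [EuclideanSpace.norm_eq]
  have hbdd : BddAbove {r : ℝ | ∃ x : n → ℝ, Real.sqrt (∑ j, x j ^ 2) = 1 ∧
      r = Real.sqrt (∑ i, M.mulVec x i ^ 2)} := by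
    refine ⟨‖(Matrix.toEuclideanLin M).toContinuousLinearMap‖, ?_⟩
    rintro r ⟨y, hy, rfl⟩
    rw [himage]
    rw [hnorm] at hy
    simpa [hy] using (Matrix.toEuclideanLin M).toContinuousLinearMap.le_opNorm (WithLp.toLp 2 y)
  have hunit : ‖‖x‖⁻¹ • x‖ = 1 := norm_smul_inv_norm (𝕜 := ℝ) hx
  have hle : ‖Matrix.toEuclideanLin M (‖x‖⁻¹ • x)‖ ≤ specNorm M :=
    le_csSup hbdd ⟨(‖x‖⁻¹ • x).ofLp, by rw [hnorm]; exact hunit, by rw [himage]⟩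
  rw [map_smul, norm_smul, norm_inv, norm_norm, inv_mul_le_iff₀ (norm_pos_iff.2 hx)] at hle
  linarith

lemma norm_toEuclideanLin_transpose_le_specNorm_mul [DecidableEq m] [DecidableEq n]
    (M : Matrix m n ℝ) (y : EuclideanSpace ℝ m) :
    ‖Matrix.toEuclideanLin Mᵀ y‖ ≤ specNorm M * ‖y‖ := by
  set z := Matrix.toEuclideanLin Mᵀ y with hz
  have hadj : ‖z‖ ^ 2 ≤ ‖y‖ * (specNorm M * ‖z‖) := by
    have h1 : ‖z‖ ^ 2 = inner ℝ y (Matrix.toEuclideanLin M z) := by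
      rw [← real_inner_self_eq_norm_sq]
      nth_rw 1 [hz]
      rw [← Matrix.conjTranspose_eq_transpose_of_trivial,
        Matrix.toEuclideanLin_conjTranspose_eq_adjoint, LinearMap.adjoint_inner_left]
    rw [h1]
    exact (real_inner_le_norm _ _).trans
      (mul_le_mul_of_nonneg_left (norm_toEuclideanLin_le_specNorm_mul M z) (norm_nonneg _))
  rcases (norm_nonneg z).eq_or_lt with h0 | hpos
  · rw [← h0]; exact mul_nonneg (specNorm_nonneg M) (norm_nonneg _)
  · exact le_of_mul_le_mul_right (by linarith) hpos

end

lemma toLp_mul_mul_smul_row {m n : Type*} [Fintype m] [Fintype n] [DecidableEq n]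
    (P : Matrix m m ℝ) (X : Matrix m n ℝ) (A : Matrix n n ℝ) (hA : A.IsSymm) (b : ℝ) (i : m) :
    WithLp.toLp 2 ((P * X * (b • A)) i) =
      ∑ k, (P i k * b) • Matrix.toEuclideanLin A (WithLp.toLp 2 (X k)) := by
  ext d
  simp only [Matrix.mul_apply, Matrix.smul_apply, hA.apply d, WithLp.ofLp_sum, WithLp.ofLp_smul,
    Finset.sum_apply, Pi.smul_apply, smul_eq_mul, Matrix.toLpLin_toLp, Matrix.toLin'_apply,
    Matrix.mulVec, dotProduct, Finset.sum_mul, Finset.mul_sum]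
  rw [Finset.sum_comm]
  exact Finset.sum_congr rfl fun k _ => Finset.sum_congr rfl fun j _ => by ring

/-- The rows of `l2Head` are images of `gaussianMean`. -/
lemma toLp_l2Head_row {N D D' : ℕ} (WQ : Matrix (Fin D) (Fin D') ℝ) {a : ℝ}
    (ha : a ^ 2 = (Real.sqrt D')⁻¹) (X : Matrix (Fin N) (Fin D) ℝ) (i : Fin N) :
    WithLp.toLp 2 (l2Head WQ X i) = a • Matrix.toEuclideanLin WQ
      (gaussianMean i fun k => a • Matrix.toEuclideanLin WQᵀ (WithLp.toLp 2 (X k))) := by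
  have hlogit : ∀ k, -(∑ m, (WQᵀ.mulVec (X i - X k) m) ^ 2) / Real.sqrt D' =
      -‖a • Matrix.toEuclideanLin WQᵀ (WithLp.toLp 2 (X i)) -
        a • Matrix.toEuclideanLin WQᵀ (WithLp.toLp 2 (X k))‖ ^ 2 := fun k => by
    rw [← smul_sub, ← map_sub, norm_smul, mul_pow, Real.norm_eq_abs, sq_abs, ha,
      EuclideanSpace.norm_sq_eq, ← WithLp.toLp_sub]
    simp only [Matrix.toLpLin_toLp, Matrix.toLin'_apply, Real.norm_eq_abs, sq_abs]
    ring
  have hcomp : ∀ x : EuclideanSpace ℝ (Fin D), Matrix.toEuclideanLin WQ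
      (Matrix.toEuclideanLin WQᵀ x) = Matrix.toEuclideanLin (WQ * WQᵀ) x := fun x => by
    ext d
    simp [Matrix.toLpLin_apply, Matrix.mulVec_mulVec]
  have hmean : a • Matrix.toEuclideanLin WQ
      (gaussianMean i fun k => a • Matrix.toEuclideanLin WQᵀ (WithLp.toLp 2 (X k))) =
      ∑ k, ((Real.exp (-‖a • Matrix.toEuclideanLin WQᵀ (WithLp.toLp 2 (X i)) -
        a • Matrix.toEuclideanLin WQᵀ (WithLp.toLp 2 (X k))‖ ^ 2) /
        ∑ l, Real.exp (-‖a • Matrix.toEuclideanLin WQᵀ (WithLp.toLp 2 (X i)) -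
        a • Matrix.toEuclideanLin WQᵀ (WithLp.toLp 2 (X l))‖ ^ 2)) * (Real.sqrt D')⁻¹) •
        Matrix.toEuclideanLin (WQ * WQᵀ) (WithLp.toLp 2 (X k)) := by
    simp only [gaussianMean, map_smul, map_sum, hcomp, Finset.smul_sum, smul_smul]
    refine Finset.sum_congr rfl fun k _ => ?_
    rw [← ha]
    congr 1
    ring
  rw [hmean]
  rw [l2Head, toLp_mul_mul_smul_row _ _ _ (by simp [Matrix.IsSymm, Matrix.transpose_mul])]
  simp only [Matrix.of_apply, hlogit]

/-- A single head of L2 self-attention with tied query/key weights is Lipschitz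
w.r.t. the Frobenius norm, with constant at most `(√N ‖WQ‖₂²/√D')(4c + 1)`,
where `c·exp(c+1) = N − 1`. -/
theorem l2_head_lipschitz_l2
    (N D D' : ℕ) (hN : 2 ≤ N) (hD : 1 ≤ D) (hD' : 1 ≤ D')
    (WQ : Matrix (Fin D) (Fin D') ℝ)
    (c : ℝ) (hc0 : 0 ≤ c) (hc : c * Real.exp (c + 1) = (N : ℝ) - 1) :
    ∀ X X' : Matrix (Fin N) (Fin D) ℝ,
      frobNorm (l2Head WQ X - l2Head WQ X') ≤
        Real.sqrt N * specNorm WQ ^ 2 / Real.sqrt D' * (4 * c + 1) *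
          frobNorm (X - X') := by
  intro X X'
  set a := Real.sqrt (Real.sqrt D')⁻¹ with hadef
  have ha : a ^ 2 = (Real.sqrt D')⁻¹ := Real.sq_sqrt (inv_nonneg.2 (Real.sqrt_nonneg _))
  have ha0 : 0 ≤ a := Real.sqrt_nonneg _
  have hs := specNorm_nonneg WQ
  have hF : 0 ≤ frobNorm (X - X') := Real.sqrt_nonneg _
  have hinput : ∀ k, ‖WithLp.toLp 2 ((X - X') k)‖ ≤ frobNorm (X - X') := fun k => by
    rw [frobNorm_eq_sqrt_sum_norm_sq]
    exact Real.le_sqrt_of_sq_le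
      (Finset.single_le_sum (f := fun k => ‖WithLp.toLp 2 ((X - X') k)‖ ^ 2)
        (fun _ _ => sq_nonneg _) (Finset.mem_univ k))
  have hrow : ∀ i, ‖WithLp.toLp 2 ((l2Head WQ X - l2Head WQ X') i)‖ ≤
      specNorm WQ ^ 2 / Real.sqrt D' * (4 * c + 1) * frobNorm (X - X') := fun i => by
    have hmean := norm_gaussianMean_sub_le (c := c) (by simpa using hc) i
      (fun k => a • Matrix.toEuclideanLin WQᵀ (WithLp.toLp 2 (X k)))
      (fun k => a • Matrix.toEuclideanLin WQᵀ (WithLp.toLp 2 (X' k)))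
      (R := a * (specNorm WQ * frobNorm (X - X'))) (fun k => by
        rw [← smul_sub, ← map_sub, norm_smul, Real.norm_of_nonneg ha0]
        exact mul_le_mul_of_nonneg_left
          ((norm_toEuclideanLin_transpose_le_specNorm_mul WQ _).trans
            (mul_le_mul_of_nonneg_left (hinput k) hs)) ha0)
    change ‖WithLp.toLp 2 (l2Head WQ X i - l2Head WQ X' i)‖ ≤ _
    rw [WithLp.toLp_sub, toLp_l2Head_row WQ ha, toLp_l2Head_row WQ ha, ← smul_sub, ← map_sub,
      norm_smul, Real.norm_of_nonneg ha0]
    refine (mul_le_mul_of_nonneg_left ((norm_toEuclideanLin_le_specNorm_mul WQ _).trans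
      (mul_le_mul_of_nonneg_left hmean hs)) ha0).trans_eq ?_
    rw [div_eq_mul_inv, ← ha]
    ring
  rw [frobNorm_eq_sqrt_sum_norm_sq]
  calc _ ≤ Real.sqrt (∑ _i : Fin N,
        (specNorm WQ ^ 2 / Real.sqrt D' * (4 * c + 1) * frobNorm (X - X')) ^ 2) :=
        Real.sqrt_le_sqrt (Finset.sum_le_sum fun i _ => pow_le_pow_left₀ (norm_nonneg _) (hrow i) 2)
    _ = _ := by
        rw [Finset.sum_const, Finset.card_univ, Fintype.card_fin, nsmul_eq_mul,
          Real.sqrt_mul (Nat.cast_nonneg N), Real.sqrt_sq (by positivity)]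
        ring
end

section
/- LayerNorm is Lipschitz continuous. Precisely: let D ≥ 1 be an integer, ε > 0, and γ, β ∈ ℝ^D. Define LN : ℝ^D → ℝ^D by LN(x)_d = γ_d (x_d − μ(x)) / √(σ²(x) + ε) + β_d, where μ(x) = (1/D) Σ_{d=1}^D x_d and σ²(x) = (1/D) Σ_{d=1}^D (x_d − μ(x))². Then LN is Lipschitz continuous: there exists a constant K ≥ 0 such that ‖LN(x) − LN(x')‖₂ ≤ K ‖x − x'‖₂ for all x, x' ∈ ℝ^D. -/
open BigOperators

/-- LayerNorm: `LN(x)_d = γ_d (x_d − μ(x)) / √(σ²(x) + ε) + β_d` where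
`μ(x)` is the mean and `σ²(x)` the (biased) variance of the entries of `x`. -/
noncomputable def layerNorm {D : ℕ} (ε : ℝ) (γ β : Fin D → ℝ)
    (x : Fin D → ℝ) : Fin D → ℝ :=
  fun d =>
    γ d * (x d - (∑ e, x e) / D) /
      Real.sqrt ((∑ e, (x e - (∑ e', x e') / D) ^ 2) / D + ε) + β d

/-- The map `y ↦ y / √(c ‖y‖² + ε)` on a normed space is Lipschitz with constant `2 / √ε`. -/
theorem norm_inv_sqrt_smul_sub_le {E : Type*} [NormedAddCommGroup E] [NormedSpace ℝ E]
    {c ε : ℝ} (hc : 0 ≤ c) (hε : 0 < ε) (y z : E) :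
    ‖(√(c * ‖y‖ ^ 2 + ε))⁻¹ • y - (√(c * ‖z‖ ^ 2 + ε))⁻¹ • z‖ ≤ 2 / √ε * ‖y - z‖ := by
  have key (a : ℝ) : 0 < c * a ^ 2 + ε := by positivity
  have hS := Real.sqrt_pos.2 (key ‖y‖)
  have hT := Real.sqrt_pos.2 (key ‖z‖)
  have hS2 := Real.sq_sqrt (key ‖y‖).le
  have hT2 := Real.sq_sqrt (key ‖z‖).le
  have hεS : √ε ≤ √(c * ‖y‖ ^ 2 + ε) := Real.sqrt_le_sqrt (by nlinarith [sq_nonneg ‖y‖])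
  have hε' := Real.sqrt_pos.2 hε
  have ha := norm_nonneg y
  have hb := norm_nonneg z
  have hab := abs_norm_sub_norm_le y z
  set S := √(c * ‖y‖ ^ 2 + ε)
  set T := √(c * ‖z‖ ^ 2 + ε)
  have hprod : c * ‖y‖ * ‖z‖ ≤ S * T := by
    refine abs_le_of_sq_le_sq' ?_ (by positivity) |>.2
    rw [mul_pow S T, hS2, hT2]
    nlinarith [mul_nonneg hc (sq_nonneg ‖y‖), mul_nonneg hc (sq_nonneg ‖z‖)]
  have hdiff : ‖z‖ * |T - S| ≤ T * ‖y - z‖ := by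
    have hfac : |T - S| * (T + S) = c * (‖y‖ + ‖z‖) * |‖y‖ - ‖z‖| := by
      rw [← abs_of_pos (add_pos hT hS), ← abs_mul,
        ← abs_of_nonneg (mul_nonneg hc (add_nonneg ha hb)), ← abs_mul, ← abs_neg]
      congr 1
      linarith
    refine le_of_mul_le_mul_right ?_ (add_pos hT hS)
    calc ‖z‖ * |T - S| * (T + S) = (c * ‖y‖ * ‖z‖ + c * ‖z‖ ^ 2) * |‖y‖ - ‖z‖| := by
          rw [mul_assoc, hfac]; ring
      _ ≤ (S * T + T ^ 2) * ‖y - z‖ := by gcongr; linarith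
      _ = T * ‖y - z‖ * (T + S) := by ring
  have hsplit : S⁻¹ • y - T⁻¹ • z = S⁻¹ • (y - z) + ((T - S) / (S * T)) • z := by
    rw [show (T - S) / (S * T) = S⁻¹ - T⁻¹ by field_simp]
    module
  calc ‖S⁻¹ • y - T⁻¹ • z‖ ≤ S⁻¹ * ‖y - z‖ + |T - S| / (S * T) * ‖z‖ := by
        rw [hsplit]
        refine (norm_add_le _ _).trans_eq ?_
        rw [norm_smul, norm_smul, Real.norm_eq_abs, Real.norm_eq_abs, abs_div,
          abs_of_pos (mul_pos hS hT), abs_of_pos (inv_pos.2 hS)]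
    _ ≤ S⁻¹ * ‖y - z‖ + T * ‖y - z‖ / (S * T) := by
        rw [div_mul_eq_mul_div, mul_comm |T - S|]; gcongr
    _ = 2 / S * ‖y - z‖ := by field_simp; ring
    _ ≤ 2 / √ε * ‖y - z‖ := by gcongr

/-- The matrix of the map subtracting from a vector the mean of its entries. -/
noncomputable def centeringMatrix (D : ℕ) : Matrix (Fin D) (Fin D) ℝ :=
  1 - (D : ℝ)⁻¹ • Matrix.of fun _ _ => 1

theorem centeringMatrix_mulVec {D : ℕ} (x : Fin D → ℝ) (d : Fin D) :
    (centeringMatrix D).mulVec x d = x d - (∑ e, x e) / D := by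
  rw [centeringMatrix, Matrix.sub_mulVec, Matrix.smul_mulVec, Matrix.one_mulVec]
  simp [Matrix.mulVec, dotProduct, div_eq_inv_mul]

theorem toLp_layerNorm {D : ℕ} (ε : ℝ) (γ β x : Fin D → ℝ) :
    WithLp.toLp 2 (layerNorm ε γ β x) =
      Matrix.toEuclideanCLM (𝕜 := ℝ) (Matrix.diagonal γ)
        ((√((D : ℝ)⁻¹ * ‖Matrix.toEuclideanCLM (𝕜 := ℝ) (centeringMatrix D)
            (WithLp.toLp 2 x)‖ ^ 2 + ε))⁻¹ •
          Matrix.toEuclideanCLM (𝕜 := ℝ) (centeringMatrix D) (WithLp.toLp 2 x)) +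
        WithLp.toLp 2 β := by
  ext d
  simp only [layerNorm, EuclideanSpace.real_norm_sq_eq, centeringMatrix_mulVec,
    map_smul, PiLp.add_apply, PiLp.smul_apply, Matrix.ofLp_toEuclideanCLM, Matrix.mulVec_diagonal,
    smul_eq_mul, div_eq_inv_mul]

/-- LayerNorm is Lipschitz continuous (w.r.t. the Euclidean norm). -/
theorem layerNorm_lipschitz
    (D : ℕ) (hD : 1 ≤ D) (ε : ℝ) (hε : 0 < ε) (γ β : Fin D → ℝ) :
    ∃ K : ℝ, 0 ≤ K ∧ ∀ x x' : Fin D → ℝ,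
      Real.sqrt (∑ d, (layerNorm ε γ β x d - layerNorm ε γ β x' d) ^ 2) ≤
        K * Real.sqrt (∑ d, (x d - x' d) ^ 2) := by
  set G := Matrix.toEuclideanCLM (𝕜 := ℝ) (Matrix.diagonal γ) with hG
  set C := Matrix.toEuclideanCLM (𝕜 := ℝ) (centeringMatrix D) with hC
  have hdist (u v : Fin D → ℝ) :
      √(∑ d, (u d - v d) ^ 2) = ‖WithLp.toLp 2 u - WithLp.toLp 2 v‖ := by
    simp [EuclideanSpace.norm_eq]
  refine ⟨‖G‖ * (2 / √ε * ‖C‖), by positivity, fun x x' => ?_⟩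
  rw [hdist, hdist, toLp_layerNorm, toLp_layerNorm, ← hG, ← hC, add_sub_add_right_eq_sub,
    ← map_sub, mul_assoc, mul_assoc]
  refine (G.le_opNorm _).trans (mul_le_mul_of_nonneg_left ?_ (norm_nonneg G))
  refine (norm_inv_sqrt_smul_sub_le (by positivity) hε _ _).trans ?_
  rw [← map_sub]
  gcongr
  exact C.le_opNorm _
end
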